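/- Let N ≥ 1 and let H' be a 5-uniform hypergraph on vertex set {0, 1, ..., N−1} containing no 7 vertices all of whose 5-subsets are edges. Define a 6-uniform hypergraph H on {0, 1, ..., 2^N − 1} by: a 6-tuple e = (a_1 < ... < a_6) is an edge of H if and only if either (I) m(e) = 0 and {δ_1, ..., δ_5} is an edge of H', or (II) m(e) ∈ {2, 3} and δ_1 < δ_2, or (III) m(e) = 3, δ_1 > δ_2, and moreover δ_1 > δ_3 or δ_3 < δ_5. Then H contains no 8 vertices all of whose 6-subsets are edges. -/

import Mathlib

/-- For distinct nonnegative integers `a` and `b`, `bdelta a b` is the largest index `i`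
such that the `i`-th binary digits of `a` and `b` differ. -/
noncomputable def bdelta (a b : ℕ) : ℕ := sSup {i | a.testBit i ≠ b.testBit i}

/-- For a tuple `a 1 < a 2 < ⋯` of nonnegative integers, `dseq a i = δ(a i, a (i+1))`. -/
noncomputable def dseq (a : ℕ → ℕ) (i : ℕ) : ℕ := bdelta (a i) (a (i + 1))

/-- The index `i` is a local extremum of the δ-sequence of the tuple `a`:
`δ_{i-1} < δ_i > δ_{i+1}` or `δ_{i-1} > δ_i < δ_{i+1}`. -/
def IsLocalExt (a : ℕ → ℕ) (i : ℕ) : Prop :=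
  (dseq a (i - 1) < dseq a i ∧ dseq a (i + 1) < dseq a i) ∨
    (dseq a i < dseq a (i - 1) ∧ dseq a i < dseq a (i + 1))

open Classical in
/-- `numExtrema r a` is `m(e)`: the number of local extrema of the δ-sequence
`δ_1, …, δ_{r-1}` of an increasing `r`-tuple `e = (a 1, …, a r)`; the possible local extrema
are the indices `2 ≤ i ≤ r - 2`. -/
noncomputable def numExtrema (r : ℕ) (a : ℕ → ℕ) : ℕ :=
  ((Finset.Icc 2 (r - 2)).filter (fun i => IsLocalExt a i)).card

/-- The δ-sequence `δ_1, …, δ_{r-1}` of the `r`-tuple `(a 1, …, a r)` is strictly monotone. -/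
def DMonotone (r : ℕ) (a : ℕ → ℕ) : Prop :=
  (∀ i, 1 ≤ i → i + 1 ≤ r - 1 → dseq a i < dseq a (i + 1)) ∨
    (∀ i, 1 ≤ i → i + 1 ≤ r - 1 → dseq a (i + 1) < dseq a i)

/-- For `a ≠ b`, the bits at positions `≥ j` all agree iff `bdelta a b < j`. -/
theorem bdelta_lt_iff {a b : ℕ} (hab : a ≠ b) (j : ℕ) :
    bdelta a b < j ↔ a / 2 ^ j = b / 2 ^ j := by
  have hbdd : BddAbove {i | a.testBit i ≠ b.testBit i} := by
    refine ⟨a + b, fun i hi => ?_⟩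
    by_contra! h
    have hi' := Nat.lt_two_pow_self (n := i)
    exact hi (by rw [Nat.testBit_lt_two_pow (by omega), Nat.testBit_lt_two_pow (by omega)])
  have hnonempty : {i | a.testBit i ≠ b.testBit i}.Nonempty := Nat.exists_testBit_ne_of_ne hab
  constructor
  · intro h
    refine Nat.eq_of_testBit_eq fun i => ?_
    rw [Nat.testBit_div_two_pow, Nat.testBit_div_two_pow]
    by_contra hi
    have : i + j ≤ bdelta a b := le_csSup hbdd hi
    omega
  · intro h
    by_contra! hj
    refine Nat.sSup_mem hnonempty hbdd ?_
    change a.testBit (bdelta a b) = b.testBit (bdelta a b)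
    obtain ⟨k, hk⟩ := Nat.exists_eq_add_of_le' hj
    rw [hk, ← Nat.testBit_div_two_pow, ← Nat.testBit_div_two_pow, h]

theorem bdelta_lt {a b N : ℕ} (hab : a < b) (hb : b < 2 ^ N) : bdelta a b < N := by
  rw [bdelta_lt_iff hab.ne, Nat.div_eq_of_lt hb, Nat.div_eq_of_lt (hab.trans hb)]

theorem bdelta_eq_max {a b c : ℕ} (hab : a < b) (hbc : b < c) :
    bdelta a c = max (bdelta a b) (bdelta b c) := by
  refine eq_of_forall_gt_iff fun j => ?_
  rw [max_lt_iff, bdelta_lt_iff hab.ne, bdelta_lt_iff hbc.ne, bdelta_lt_iff (hab.trans hbc).ne]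
  have h₁ : a / 2 ^ j ≤ b / 2 ^ j := Nat.div_le_div_right hab.le
  have h₂ : b / 2 ^ j ≤ c / 2 ^ j := Nat.div_le_div_right hbc.le
  omega

/-- The five numbers are strictly monotone in the given order. -/
def Monotone5 (d₁ d₂ d₃ d₄ d₅ : ℕ) : Prop :=
  (d₁ < d₂ ∧ d₂ < d₃ ∧ d₃ < d₄ ∧ d₄ < d₅) ∨ (d₂ < d₁ ∧ d₃ < d₂ ∧ d₄ < d₃ ∧ d₅ < d₄)

/-- The order patterns of δ-sequences of edges of the 6-uniform hypergraph: strictly monotone,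
or starting with an ascent and having at least two local extrema, or alternating, starting with
a descent and satisfying the extra condition in the third kind of edges. -/
def EdgePattern (d₁ d₂ d₃ d₄ d₅ : ℕ) : Prop :=
  Monotone5 d₁ d₂ d₃ d₄ d₅ ∨
  (d₁ < d₂ ∧ (d₃ < d₂ ∧ (d₃ < d₄ ∨ d₄ < d₅) ∨ d₄ < d₃ ∧ d₄ < d₅)) ∨
  (d₂ < d₁ ∧ d₂ < d₃ ∧ d₄ < d₃ ∧ d₄ < d₅ ∧ (d₃ < d₁ ∨ d₃ < d₅))

theorem monotone_of_edgePattern {x₁ x₂ x₃ x₄ x₅ x₆ x₇ : ℕ}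
    (g₁ : EdgePattern (max x₁ x₂) x₃ x₄ (max x₅ x₆) x₇)
    (g₂ : EdgePattern x₁ x₂ x₃ (max (max x₄ x₅) x₆) x₇)
    (g₃ : EdgePattern (max (max x₁ x₂) x₃) x₄ x₅ x₆ x₇)
    (g₄ : EdgePattern x₁ x₂ (max x₃ x₄) x₅ x₆)
    (g₅ : EdgePattern (max x₁ x₂) x₃ x₄ x₅ x₆)
    (g₆ : EdgePattern x₁ x₂ x₃ x₄ x₅) :
    (x₁ < x₂ ∧ x₂ < x₃ ∧ x₃ < x₄ ∧ x₄ < x₅ ∧ x₅ < x₆ ∧ x₆ < x₇) ∨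
    (x₂ < x₁ ∧ x₃ < x₂ ∧ x₄ < x₃ ∧ x₅ < x₄ ∧ x₆ < x₅ ∧ x₇ < x₆) := by
  unfold EdgePattern Monotone5 at *
  rcases g₆ with (g₆ | g₆) | g₆ | g₆ <;> omega

open Classical in
theorem numExtrema_six (a : ℕ → ℕ) :
    numExtrema 6 a = (if IsLocalExt a 2 then 1 else 0) + (if IsLocalExt a 3 then 1 else 0) +
      (if IsLocalExt a 4 then 1 else 0) := by
  have h : Finset.Icc 2 (6 - 2) = {2, 3, 4} := rfl
  rw [numExtrema, h, Finset.card_filter, Finset.sum_insert (by decide),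
    Finset.sum_insert (by decide), Finset.sum_singleton, add_assoc]

/-- What the definition of the 6-uniform hypergraph says about an edge `{c₁ < ⋯ < c₆}`. -/
theorem edge_condition {N : ℕ} {E' E : Finset ℕ → Prop}
    (hE : ∀ a : ℕ → ℕ, (∀ i, 1 ≤ i → i < 6 → a i < a (i + 1)) → a 6 < 2 ^ N →
      (E ((Finset.Icc 1 6).image a) ↔
        (DMonotone 6 a ∧
          E' ({dseq a 1, dseq a 2, dseq a 3, dseq a 4, dseq a 5} : Finset ℕ)) ∨
        ((numExtrema 6 a = 2 ∨ numExtrema 6 a = 3) ∧ dseq a 1 < dseq a 2) ∨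
        (numExtrema 6 a = 3 ∧ dseq a 2 < dseq a 1 ∧
          (dseq a 3 < dseq a 1 ∨ dseq a 3 < dseq a 5))))
    {c₁ c₂ c₃ c₄ c₅ c₆ : ℕ} (h₁ : c₁ < c₂) (h₂ : c₂ < c₃) (h₃ : c₃ < c₄) (h₄ : c₄ < c₅)
    (h₅ : c₅ < c₆) (h₆ : c₆ < 2 ^ N) (hedge : E {c₁, c₂, c₃, c₄, c₅, c₆}) :
    EdgePattern (bdelta c₁ c₂) (bdelta c₂ c₃) (bdelta c₃ c₄) (bdelta c₄ c₅) (bdelta c₅ c₆) ∧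
    (Monotone5 (bdelta c₁ c₂) (bdelta c₂ c₃) (bdelta c₃ c₄) (bdelta c₄ c₅) (bdelta c₅ c₆) →
      E' {bdelta c₁ c₂, bdelta c₂ c₃, bdelta c₃ c₄, bdelta c₄ c₅, bdelta c₅ c₆}) := by
  let a : ℕ → ℕ
    | 1 => c₁ | 2 => c₂ | 3 => c₃ | 4 => c₄ | 5 => c₅ | _ => c₆
  have ha : ∀ i, 1 ≤ i → i < 6 → a i < a (i + 1) := by
    intro i hi hi'
    interval_cases i <;> assumption
  have himage : (Finset.Icc 1 6).image a = {c₁, c₂, c₃, c₄, c₅, c₆} := by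
    have h : Finset.Icc 1 6 = {1, 2, 3, 4, 5, 6} := rfl
    simp only [h, Finset.image_insert, Finset.image_singleton, a]
  have hmono : DMonotone 6 a ↔ Monotone5 (dseq a 1) (dseq a 2) (dseq a 3) (dseq a 4)
      (dseq a 5) := by
    constructor
    · exact Or.imp
        (fun h => ⟨h 1 (by omega) (by omega), h 2 (by omega) (by omega),
          h 3 (by omega) (by omega), h 4 (by omega) (by omega)⟩)
        (fun h => ⟨h 1 (by omega) (by omega), h 2 (by omega) (by omega),
          h 3 (by omega) (by omega), h 4 (by omega) (by omega)⟩)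
    · refine Or.imp ?_ ?_ <;>
      · rintro ⟨k₁, k₂, k₃, k₄⟩ i hi hi'
        have : i < 5 := by omega
        interval_cases i <;> assumption
  have h := (hE a ha h₆).1 (himage ▸ hedge)
  change EdgePattern (dseq a 1) (dseq a 2) (dseq a 3) (dseq a 4) (dseq a 5) ∧
    (Monotone5 (dseq a 1) (dseq a 2) (dseq a 3) (dseq a 4) (dseq a 5) →
      E' {dseq a 1, dseq a 2, dseq a 3, dseq a 4, dseq a 5})
  rw [hmono] at h
  rcases h with ⟨hm, hE'⟩ | h
  · exact ⟨Or.inl hm, fun _ => hE'⟩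
  · rw [numExtrema_six] at h
    unfold EdgePattern Monotone5
    by_cases e₂ : IsLocalExt a 2 <;> by_cases e₃ : IsLocalExt a 3 <;>
      by_cases e₄ : IsLocalExt a 4 <;> simp only [e₂, e₃, e₄, if_true, if_false] at h <;>
      simp only [IsLocalExt, Nat.add_one_sub_one, Nat.reduceAdd] at e₂ e₃ e₄ <;>
      exact ⟨by omega, fun hm => absurd h (by omega)⟩

theorem exists_increasing_preimage {x : ℕ → ℕ} {n : ℕ} (hx : Set.InjOn x (Finset.range n))
    {e : Finset ℕ} (he : e ⊆ (Finset.range n).image x) (hcard : e.card = 5) :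
    ∃ t₁ t₂ t₃ t₄ t₅, t₁ < t₂ ∧ t₂ < t₃ ∧ t₃ < t₄ ∧ t₄ < t₅ ∧ t₅ < n ∧
      e = {x t₁, x t₂, x t₃, x t₄, x t₅} := by
  obtain ⟨T, hT, rfl⟩ := Finset.subset_image_iff.1 he
  rw [Finset.card_image_of_injOn (hx.mono hT)] at hcard
  let t := T.orderEmbOfFin hcard
  have htT : Finset.univ.image t = T := by simp [t]
  refine ⟨t 0, t 1, t 2, t 3, t 4, t.strictMono (by decide), t.strictMono (by decide),
    t.strictMono (by decide), t.strictMono (by decide),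
    Finset.mem_range.1 (hT (T.orderEmbOfFin_mem hcard 4)), ?_⟩
  have huniv : (Finset.univ : Finset (Fin 5)) = {0, 1, 2, 3, 4} := rfl
  rw [← htT, huniv]
  simp only [Finset.image_insert, Finset.image_singleton]

/-- Let `N ≥ 1` and let `E'` be a 5-uniform hypergraph on `{0,…,N-1}` containing no 7 vertices
all of whose 5-subsets are edges. Define a 6-uniform hypergraph `E` on `{0,…,2^N - 1}` by: a
6-tuple `e = (a₁ < ⋯ < a₆)` is an edge iff (I) `m(e) = 0` (its δ-sequence is strictly
monotone) and `{δ₁,…,δ₅}` is an edge of `E'`, or (II) `m(e) ∈ {2, 3}` and `δ₁ < δ₂`, or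
(III) `m(e) = 3`, `δ₁ > δ₂`, and moreover `δ₁ > δ₃` or `δ₃ < δ₅`.
Then `E` contains no 8 vertices all of whose 6-subsets are edges. -/
theorem stmt18 (N : ℕ) (hN : 1 ≤ N) (E' : Finset ℕ → Prop)
    (hE' : ¬ ∃ S ⊆ Finset.range N, S.card = 7 ∧ ∀ e ⊆ S, e.card = 5 → E' e)
    (E : Finset ℕ → Prop)
    (hE : ∀ a : ℕ → ℕ, (∀ i, 1 ≤ i → i < 6 → a i < a (i + 1)) → a 6 < 2 ^ N →
      (E ((Finset.Icc 1 6).image a) ↔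
        (DMonotone 6 a ∧
          E' ({dseq a 1, dseq a 2, dseq a 3, dseq a 4, dseq a 5} : Finset ℕ)) ∨
        ((numExtrema 6 a = 2 ∨ numExtrema 6 a = 3) ∧ dseq a 1 < dseq a 2) ∨
        (numExtrema 6 a = 3 ∧ dseq a 2 < dseq a 1 ∧
          (dseq a 3 < dseq a 1 ∨ dseq a 3 < dseq a 5)))) :
    ¬ ∃ S ⊆ Finset.range (2 ^ N), S.card = 8 ∧ ∀ e ⊆ S, e.card = 6 → E e := by
  rintro ⟨S, hS, hcard, hclique⟩
  let f := S.orderEmbOfFin hcard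
  let b : ℕ → ℕ := fun i => f (Fin.ofNat 8 i)
  have hb : ∀ i j, i < j → j < 8 → b i < b j := by
    intro i j hij hj
    refine f.strictMono ?_
    simp only [Fin.lt_def, Fin.ofNat]
    omega
  have hbS : ∀ i, b i ∈ S := fun i => S.orderEmbOfFin_mem hcard _
  have hbN : ∀ i, b i < 2 ^ N := fun i => Finset.mem_range.1 (hS (hbS i))
  have hmax : ∀ i j k, i < j → j < k → k < 8 →
      bdelta (b i) (b k) = max (bdelta (b i) (b j)) (bdelta (b j) (b k)) :=
    fun i j k hij hjk hk => bdelta_eq_max (hb i j hij (by omega)) (hb j k hjk hk)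
  have key : ∀ i₁ i₂ i₃ i₄ i₅ i₆, i₁ < i₂ → i₂ < i₃ → i₃ < i₄ → i₄ < i₅ → i₅ < i₆ → i₆ < 8 →
      EdgePattern (bdelta (b i₁) (b i₂)) (bdelta (b i₂) (b i₃)) (bdelta (b i₃) (b i₄))
        (bdelta (b i₄) (b i₅)) (bdelta (b i₅) (b i₆)) ∧
      (Monotone5 (bdelta (b i₁) (b i₂)) (bdelta (b i₂) (b i₃)) (bdelta (b i₃) (b i₄))
        (bdelta (b i₄) (b i₅)) (bdelta (b i₅) (b i₆)) →
        E' {bdelta (b i₁) (b i₂), bdelta (b i₂) (b i₃), bdelta (b i₃) (b i₄),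
          bdelta (b i₄) (b i₅), bdelta (b i₅) (b i₆)}) := by
    intro i₁ i₂ i₃ i₄ i₅ i₆ h₁ h₂ h₃ h₄ h₅ h₆
    have l₁ := hb i₁ i₂ h₁ (by omega)
    have l₂ := hb i₂ i₃ h₂ (by omega)
    have l₃ := hb i₃ i₄ h₃ (by omega)
    have l₄ := hb i₄ i₅ h₄ (by omega)
    have l₅ := hb i₅ i₆ h₅ h₆
    refine edge_condition hE l₁ l₂ l₃ l₄ l₅ (hbN i₆) (hclique _ ?_ ?_)
    · simp [Finset.insert_subset_iff, hbS]
    · repeat rw [Finset.card_insert_of_notMem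
        (by simp only [Finset.mem_insert, Finset.mem_singleton]; omega)]
      rfl
  have hmono : (∀ i, i + 2 < 8 → dseq b i < dseq b (i + 1)) ∨
      (∀ i, i + 2 < 8 → dseq b (i + 1) < dseq b i) := by
    have g₁ := (key 0 2 3 4 6 7 (by omega) (by omega) (by omega) (by omega) (by omega)
      (by omega)).1
    have g₂ := (key 0 1 2 3 6 7 (by omega) (by omega) (by omega) (by omega) (by omega)
      (by omega)).1
    have g₃ := (key 0 3 4 5 6 7 (by omega) (by omega) (by omega) (by omega) (by omega)
      (by omega)).1
    have g₄ := (key 0 1 2 4 5 6 (by omega) (by omega) (by omega) (by omega) (by omega)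
      (by omega)).1
    have g₅ := (key 0 2 3 4 5 6 (by omega) (by omega) (by omega) (by omega) (by omega)
      (by omega)).1
    have g₆ := (key 0 1 2 3 4 5 (by omega) (by omega) (by omega) (by omega) (by omega)
      (by omega)).1
    rw [hmax 0 1 2 (by omega) (by omega) (by omega)] at g₁ g₅
    rw [hmax 4 5 6 (by omega) (by omega) (by omega)] at g₁
    rw [hmax 3 5 6 (by omega) (by omega) (by omega),
      hmax 3 4 5 (by omega) (by omega) (by omega)] at g₂
    rw [hmax 0 2 3 (by omega) (by omega) (by omega),
      hmax 0 1 2 (by omega) (by omega) (by omega)] at g₃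
    rw [hmax 2 3 4 (by omega) (by omega) (by omega)] at g₄
    refine (monotone_of_edgePattern g₁ g₂ g₃ g₄ g₅ g₆).imp ?_ ?_ <;>
    · rintro ⟨h₁, h₂, h₃, h₄, h₅, h₆⟩ i hi
      have : i < 6 := by omega
      interval_cases i <;> assumption
  have hdN : ∀ i, i < 7 → dseq b i < N := fun i hi =>
    bdelta_lt (hb i (i + 1) (by omega) (by omega)) (hbN _)
  have hsub : (Finset.range 7).image (dseq b) ⊆ Finset.range N := by
    intro x hx
    obtain ⟨i, hi, rfl⟩ := Finset.mem_image.1 hx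
    exact Finset.mem_range.2 (hdN i (Finset.mem_range.1 hi))
  rcases hmono with hinc | hdec
  · have hlt : ∀ i j, i < j → j < 7 → dseq b i < dseq b j := by
      intro i j hij
      induction j, hij using Nat.le_induction with
      | base => exact fun h => hinc i (by omega)
      | succ j hij ih => exact fun h => (ih (by omega)).trans (hinc j (by omega))
    have hdelta : ∀ i j, i < j + 1 → j < 7 → bdelta (b i) (b (j + 1)) = dseq b j := by
      intro i j hij hj
      rcases Nat.lt_succ_iff_lt_or_eq.1 hij with h | rfl
      · induction j, h using Nat.le_induction with
        | base =>
          rw [hmax i (i + 1) (i + 1 + 1) (by omega) (by omega) (by omega)]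
          exact max_eq_right (hlt i (i + 1) (by omega) hj).le
        | succ j h ih =>
          rw [hmax i (j + 1) (j + 1 + 1) (by omega) (by omega) (by omega),
            ih (by omega) (by omega)]
          exact max_eq_right (hlt j (j + 1) (by omega) hj).le
      · rfl
    have hinj : Set.InjOn (dseq b) (Finset.range 7) := by
      intro i hi j hj h
      simp only [Finset.coe_range, Set.mem_Iio] at hi hj
      by_contra hij
      rcases lt_or_gt_of_ne hij with hij | hij
      · exact (hlt i j hij hj).ne h
      · exact (hlt j i hij hi).ne h.symm
    refine hE' ⟨_, hsub, by rw [Finset.card_image_of_injOn hinj]; rfl, fun e he hcard5 => ?_⟩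
    obtain ⟨t₁, t₂, t₃, t₄, t₅, h₁, h₂, h₃, h₄, h₅, rfl⟩ :=
      exists_increasing_preimage hinj he hcard5
    have k := (key 0 (t₁ + 1) (t₂ + 1) (t₃ + 1) (t₄ + 1) (t₅ + 1) (by omega) (by omega)
      (by omega) (by omega) (by omega) (by omega)).2
    rw [hdelta _ _ (by omega) (by omega), hdelta _ _ (by omega) (by omega),
      hdelta _ _ (by omega) (by omega), hdelta _ _ (by omega) (by omega),
      hdelta _ _ (by omega) (by omega)] at k
    exact k (Or.inl ⟨hlt _ _ h₁ (by omega), hlt _ _ h₂ (by omega), hlt _ _ h₃ (by omega),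
      hlt _ _ h₄ (by omega)⟩)
  · have hlt : ∀ i j, i < j → j < 7 → dseq b j < dseq b i := by
      intro i j hij
      induction j, hij using Nat.le_induction with
      | base => exact fun h => hdec i (by omega)
      | succ j hij ih => exact fun h => (hdec j (by omega)).trans (ih (by omega))
    have hdelta : ∀ i j, i < j → j < 8 → bdelta (b i) (b j) = dseq b i := by
      intro i j hij
      induction j, hij using Nat.le_induction with
      | base => exact fun _ => rfl
      | succ j h ih =>
        intro hj
        rw [hmax i j (j + 1) (by omega) (by omega) (by omega), ih (by omega)]
        exact max_eq_left (hlt i j (by omega) (by omega)).le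
    have hinj : Set.InjOn (dseq b) (Finset.range 7) := by
      intro i hi j hj h
      simp only [Finset.coe_range, Set.mem_Iio] at hi hj
      by_contra hij
      rcases lt_or_gt_of_ne hij with hij | hij
      · exact (hlt i j hij hj).ne h.symm
      · exact (hlt j i hij hi).ne h
    refine hE' ⟨_, hsub, by rw [Finset.card_image_of_injOn hinj]; rfl, fun e he hcard5 => ?_⟩
    obtain ⟨t₁, t₂, t₃, t₄, t₅, h₁, h₂, h₃, h₄, h₅, rfl⟩ :=
      exists_increasing_preimage hinj he hcard5
    have k := (key t₁ t₂ t₃ t₄ t₅ 7 h₁ h₂ h₃ h₄ h₅ (by omega)).2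
    rw [hdelta _ _ h₁ (by omega), hdelta _ _ h₂ (by omega), hdelta _ _ h₃ (by omega),
      hdelta _ _ h₄ (by omega), hdelta _ _ h₅ (by omega)] at k
    exact k (Or.inr ⟨hlt _ _ h₁ (by omega), hlt _ _ h₂ (by omega), hlt _ _ h₃ (by omega),
      hlt _ _ h₄ (by omega)⟩)
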